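/- arXiv:1706.02156 — 2 statements merged into one kernel-verified Lean document; each statement's English description precedes it below -/
import Mathlib

section
/- Let k be a field with char k = 0 or char k > (n+1)/2, and \Lambda the exterior algebra on x_1,...,x_n,y_1,...,y_n over k with w = \sum_i x_i y_i. Then the total k-dimension of the cokernel of multiplication by w (as a map \Lambda \to \Lambda of degree 2) plus the total k-dimension of its kernel equals the central binomial coefficient C(2n+2, n+1). -/
open ExteriorAlgebra Module

/-- The operator `(a,b,c,d) ↦ (fa, fb, fc, fd + a)`. -/
def liftOp {k E : Type*} [Field k] [AddCommGroup E] [Module k E] (f : E →ₗ[k] E) :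
    (E × E × E × E) →ₗ[k] (E × E × E × E) where
  toFun t := (f t.1, f t.2.1, f t.2.2.1, f t.2.2.2 + t.1)
  map_add' s t := by
    simp only [Prod.fst_add, Prod.snd_add, map_add, Prod.mk_add_mk, Prod.mk.injEq, true_and]
    abel
  map_smul' r t := by simp

theorem liftOp_pow {k E : Type*} [Field k] [AddCommGroup E] [Module k E] (f : E →ₗ[k] E)
    (i : ℕ) (t : E × E × E × E) :
    (liftOp f ^ (i + 1)) t = ((f ^ (i + 1)) t.1, (f ^ (i + 1)) t.2.1, (f ^ (i + 1)) t.2.2.1,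
      (f ^ (i + 1)) t.2.2.2 + ((i : k) + 1) • (f ^ i) t.1) := by
  induction i with
  | zero => simp [liftOp]
  | succ i ih =>
    rw [pow_succ', Module.End.mul_apply, ih]
    simp only [liftOp, LinearMap.coe_mk, AddHom.coe_mk, pow_succ' f (i + 1), Module.End.mul_apply,
      map_add, map_smul, pow_succ' f i, Prod.mk.injEq, true_and]
    push_cast
    module

/-- The change of coordinates `(a,b,c,d) ↦ (a + r f d, b, c, d)`. -/
def shearOp {k E : Type*} [Field k] [AddCommGroup E] [Module k E] (f : E →ₗ[k] E) (r : k) :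
    (E × E × E × E) ≃ₗ[k] (E × E × E × E) where
  toFun t := (t.1 + r • f t.2.2.2, t.2.1, t.2.2.1, t.2.2.2)
  invFun t := (t.1 - r • f t.2.2.2, t.2.1, t.2.2.1, t.2.2.2)
  map_add' s t := by
    simp only [Prod.fst_add, Prod.snd_add, map_add, Prod.mk_add_mk, Prod.mk.injEq, and_self,
      and_true]
    module
  map_smul' c t := by
    simp only [Prod.smul_fst, Prod.smul_snd, map_smul, Prod.smul_mk, Prod.mk.injEq, and_self,
      and_true, RingHom.id_apply]
    module
  left_inv t := by simp
  right_inv t := by simp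

theorem finrank_sub_prod {k A B : Type*} [Field k] [AddCommGroup A] [Module k A]
    [Module.Finite k A] [AddCommGroup B] [Module k B] [Module.Finite k B]
    (p : Submodule k A) (q : Submodule k B) :
    finrank k (p.prod q) = finrank k p + finrank k q := by
  let e : (p.prod q) ≃ₗ[k] (p × q) :=
    { toFun := fun t => (⟨t.1.1, t.2.1⟩, ⟨t.1.2, t.2.2⟩)
      invFun := fun t => ⟨(t.1.1, t.2.1), t.1.2, t.2.2⟩
      map_add' := fun _ _ => rfl
      map_smul' := fun _ _ => rfl
      left_inv := fun _ => rfl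
      right_inv := fun _ => rfl }
  rw [e.finrank_eq, Module.finrank_prod]

theorem finrank_ker_liftOp {k E : Type*} [Field k] [AddCommGroup E] [Module k E]
    [Module.Finite k E] (f : E →ₗ[k] E) (i : ℕ) (h : (i : k) + 1 ≠ 0 ∨ f ^ i = 0) :
    finrank k (LinearMap.ker (liftOp f ^ (i + 1))) =
      2 * finrank k (LinearMap.ker (f ^ (i + 1))) + finrank k (LinearMap.ker (f ^ i))
        + finrank k (LinearMap.ker (f ^ (i + 2))) := by
  have key : LinearMap.ker (liftOp f ^ (i + 1)) =
      ((LinearMap.ker (f ^ i)).prod ((LinearMap.ker (f ^ (i + 1))).prod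
        ((LinearMap.ker (f ^ (i + 1))).prod (LinearMap.ker (f ^ (i + 2)))))).comap
        (shearOp f ((i : k) + 1)⁻¹).toLinearMap := by
    ext ⟨a, b, c, d⟩
    simp only [LinearMap.mem_ker, liftOp_pow, Submodule.mem_comap, Submodule.mem_prod, shearOp,
      LinearEquiv.coe_coe, LinearEquiv.coe_mk, LinearMap.coe_mk, AddHom.coe_mk, Prod.mk_eq_zero,
      map_add, map_smul]
    have e1 : (f ^ i) (f d) = (f ^ (i + 1)) d := by
      rw [pow_succ, Module.End.mul_apply]
    rw [e1]
    rcases h with h | h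
    · constructor
      · rintro ⟨h1, h2, h3, h4⟩
        have h5 : (f ^ i) a + ((i : k) + 1)⁻¹ • (f ^ (i + 1)) d = 0 := by
          have := congrArg (fun z => ((i : k) + 1)⁻¹ • z) h4
          simp only [smul_add, smul_smul, inv_mul_cancel₀ h, one_smul, smul_zero] at this
          rw [add_comm]; exact this
        refine ⟨h5, h2, h3, ?_⟩
        have := congrArg f h4
        rw [map_add, map_smul, ← Module.End.mul_apply, ← Module.End.mul_apply, ← pow_succ',
          ← pow_succ', h1, smul_zero, add_zero, map_zero] at this
        exact this
      · rintro ⟨h1, h2, h3, h4⟩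
        have h5 : (f ^ (i + 1)) d + ((i : k) + 1) • (f ^ i) a = 0 := by
          have := congrArg (fun z => ((i : k) + 1) • z) h1
          simp only [smul_add, smul_smul, mul_inv_cancel₀ h, one_smul, smul_zero] at this
          rw [add_comm]; exact this
        refine ⟨?_, h2, h3, h5⟩
        have := congrArg f h1
        rw [map_add, map_smul, ← Module.End.mul_apply, ← Module.End.mul_apply, ← pow_succ',
          ← pow_succ', h4, smul_zero, add_zero, map_zero] at this
        exact this
    · have h1 : f ^ (i + 1) = 0 := by rw [pow_succ, h, zero_mul]
      have h2 : f ^ (i + 2) = 0 := by rw [pow_succ, h1, zero_mul]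
      simp [h, h1, h2]
  rw [key, LinearEquiv.finrank_eq (LinearEquiv.ofSubmodule' _ _), finrank_sub_prod,
    finrank_sub_prod, finrank_sub_prod]
  ring

theorem kappa_rec (m i : ℕ) :
    ∑ s ∈ Finset.range (i + 1), Nat.choose (2 * (m + 1) + 1) (m + 1 + 1 + s) =
      2 * ∑ s ∈ Finset.range (i + 1), Nat.choose (2 * m + 1) (m + 1 + s)
      + ∑ s ∈ Finset.range i, Nat.choose (2 * m + 1) (m + 1 + s)
      + ∑ s ∈ Finset.range (i + 2), Nat.choose (2 * m + 1) (m + 1 + s) := by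
  have pas : ∀ t, Nat.choose (2 * (m + 1) + 1) (t + 2) = Nat.choose (2 * m + 1) t
      + 2 * Nat.choose (2 * m + 1) (t + 1) + Nat.choose (2 * m + 1) (t + 2) := by
    intro t
    rw [show 2 * (m + 1) + 1 = 2 * m + 1 + 1 + 1 by ring, Nat.choose_succ_succ,
      Nat.choose_succ_succ, Nat.choose_succ_succ (2 * m + 1) (t + 1)]
    ring
  induction i with
  | zero =>
    have := pas m
    have hs : Nat.choose (2 * m + 1) m = Nat.choose (2 * m + 1) (m + 1) :=
      Nat.choose_symm_of_eq_add (by ring)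
    simp only [Finset.sum_range_succ, Finset.sum_range_zero, zero_add, add_zero]
    rw [show m + 1 + 1 = m + 2 by ring, this, hs]
    ring
  | succ i ih =>
    rw [Finset.sum_range_succ, ih, Finset.sum_range_succ _ (i + 1), Finset.sum_range_succ _ i,
      Finset.sum_range_succ _ (i + 2), Finset.sum_range_succ _ (i + 1), Finset.sum_range_succ _ i]
    have := pas (m + 1 + i)
    rw [show m + 1 + 1 + (i + 1) = m + 1 + i + 2 by ring, this,
      show m + 1 + (i + 2) = m + 1 + i + 2 by ring, show m + 1 + (i + 1) = m + 1 + i + 1 by ring]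
    ring

theorem pair_comm {k V : Type*} [Field k] [AddCommGroup V] [Module k V] (u v : V)
    (a : ExteriorAlgebra k V) : ι k u * ι k v * a = a * (ι k u * ι k v) := by
  induction a using ExteriorAlgebra.induction with
  | algebraMap r => exact (Algebra.commutes r _).symm
  | ι z =>
    have h1 : ι k v * ι k z = -(ι k z * ι k v) := eq_neg_of_add_eq_zero_left (ι_add_mul_swap v z)
    have h2 : ι k u * ι k z = -(ι k z * ι k u) := eq_neg_of_add_eq_zero_left (ι_add_mul_swap u z)
    rw [mul_assoc, h1, mul_neg, ← mul_assoc, h2, neg_mul, neg_neg, mul_assoc]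
  | mul a b ha hb => rw [← mul_assoc, ha, mul_assoc, hb, mul_assoc]
  | add a b ha hb => rw [mul_add, ha, hb, add_mul]

universe u

/-- The model with `m` pairs of generators. -/
theorem model {k : Type u} {V : Type*} [Field k] [AddCommGroup V] [Module k V] (n : ℕ)
    (hchar : ∀ i : ℕ, 2 * (i + 1) ≤ n + 1 → (i : k) + 1 ≠ 0) (x y : ℕ → V) (m : ℕ) :
    ∃ (E : Type u) (_ : AddCommGroup E) (_ : Module k E) (_ : Module.Finite k E)
      (f : E →ₗ[k] E) (Φ : E →ₗ[k] ExteriorAlgebra k V),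
      finrank k E = 4 ^ m ∧ f ^ (m + 1) = 0 ∧
      (∀ j, m + j ≤ n + 1 → finrank k (LinearMap.ker (f ^ j)) =
        ∑ s ∈ Finset.range j, Nat.choose (2 * m + 1) (m + 1 + s)) ∧
      (∀ e, Φ (f e) = (∑ i ∈ Finset.range m, ι k (x i) * ι k (y i)) * Φ e) ∧
      (∃ e, Φ e = 1) ∧
      (∀ i < m, ∀ e, ∃ e', Φ e' = Φ e * ι k (x i)) ∧
      (∀ i < m, ∀ e, ∃ e', Φ e' = Φ e * ι k (y i)) := by
  induction m with
  | zero =>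
    refine ⟨k, inferInstance, inferInstance, inferInstance, 0, Algebra.linearMap k _, by simp,
      by simp, ?_, by simp, ⟨1, by simp⟩, by simp, by simp⟩
    intro j hj
    rcases j with _ | j
    · simp [Module.End.one_eq_id]
    · rw [zero_pow (Nat.succ_ne_zero j), LinearMap.ker_zero, finrank_top]
      simp [Finset.sum_range_succ', Nat.choose_eq_zero_of_lt]
  | succ m ih =>
    obtain ⟨E, i1, i2, i3, f, Φ, hd, hnil, hk, hw, ⟨e1, h1⟩, hx, hy⟩ := ih
    have sw : ∀ u v : V, ι k u * ι k v = -(ι k v * ι k u) := fun u v =>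
      eq_neg_of_add_eq_zero_left (ι_add_mul_swap u v)
    let X := ι k (x m)
    let Y := ι k (y m)
    let Ψ : (E × E × E × E) →ₗ[k] ExteriorAlgebra k V :=
      { toFun := fun t => Φ t.1 + Φ t.2.1 * X + Φ t.2.2.1 * Y + Φ t.2.2.2 * (X * Y)
        map_add' := by
          intro s t
          simp only [Prod.fst_add, Prod.snd_add, map_add, add_mul]
          abel
        map_smul' := by
          intro r t
          simp }
    have hΨ : ∀ a b c d, Ψ (a, b, c, d) = Φ a + Φ b * X + Φ c * Y + Φ d * (X * Y) :=
      fun _ _ _ _ => rfl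
    have XX : X * X = 0 := ι_sq_zero _
    have YY : Y * Y = 0 := ι_sq_zero _
    have YX : Y * X = -(X * Y) := sw _ _
    have old : ∀ z : V, (∀ e, ∃ e', Φ e' = Φ e * ι k z) →
        ∀ e, ∃ e', Ψ e' = Ψ e * ι k z := by
      rintro z hz ⟨a, b, c, d⟩
      obtain ⟨a', ha⟩ := hz a
      obtain ⟨b', hb⟩ := hz b
      obtain ⟨c', hc⟩ := hz c
      obtain ⟨d', hd⟩ := hz d
      have zX : X * ι k z = -(ι k z * X) := sw _ _
      have zY : Y * ι k z = -(ι k z * Y) := sw _ _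
      have zXY : X * Y * ι k z = ι k z * (X * Y) := pair_comm _ _ _
      refine ⟨(a', -b', -c', d'), ?_⟩
      simp only [hΨ, map_neg, ha, hb, hc, hd, add_mul, mul_assoc (Φ _), zX, zY, zXY, mul_neg,
        neg_mul]
    refine ⟨E × E × E × E, inferInstance, inferInstance, inferInstance, liftOp f, Ψ,
      ?_, ?_, ?_, ?_, ?_, ?_, ?_⟩
    · simp only [Module.finrank_prod, hd]; ring
    · refine LinearMap.ext fun t => ?_
      rw [liftOp_pow, pow_succ f (m + 1), hnil]
      simp
    · intro j hj
      rcases j with _ | i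
      · simp [Module.End.one_eq_id]
      · rw [finrank_ker_liftOp, hk _ (by omega), hk _ (by omega), hk _ (by omega), kappa_rec]
        by_cases hi : 2 * (i + 1) ≤ n + 1
        · exact Or.inl (hchar i hi)
        · right
          have : i = (m + 1) + (i - (m + 1)) := by omega
          rw [this, pow_add, hnil, zero_mul]
    · rintro ⟨a, b, c, d⟩
      have e : liftOp f (a, b, c, d) = (f a, f b, f c, f d + a) := rfl
      have c1 : ∀ z, X * Y * z = z * (X * Y) := fun z => pair_comm _ _ z
      have c2 : X * Y * X = 0 := by rw [c1, ← mul_assoc, XX, zero_mul]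
      have c3 : X * Y * Y = 0 := by rw [mul_assoc, YY, mul_zero]
      have c4 : X * (X * Y) = 0 := by rw [← mul_assoc, XX, zero_mul]
      have c5 : Y * (X * Y) = 0 := by rw [← c1, c3]
      have c6 : X * Y * (X * Y) = 0 := by rw [← mul_assoc, c2, zero_mul]
      rw [e, hΨ, hΨ, Finset.sum_range_succ, add_mul]
      change _ = _ + X * Y * _
      rw [c1]
      simp only [map_add, hw, add_mul, mul_add, mul_assoc (Φ _), c4, c5, c6, mul_zero, add_zero,
        ← mul_assoc (∑ i ∈ Finset.range m, ι k (x i) * ι k (y i))]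
      abel
    · exact ⟨(e1, 0, 0, 0), by simp [hΨ, h1]⟩
    · intro i hi
      rcases Nat.lt_succ_iff_lt_or_eq.mp hi with hi | rfl
      · exact old _ (hx i hi)
      · rintro ⟨a, b, c, d⟩
        refine ⟨(0, a, 0, -c), ?_⟩
        have c2 : X * Y * X = 0 := by rw [pair_comm, ← mul_assoc, XX, zero_mul]
        change _ = _ * X
        simp only [hΨ, map_neg, map_zero, zero_mul, zero_add, add_zero, add_mul,
          mul_assoc (Φ _), XX, YX, c2, mul_zero, mul_neg, neg_mul]
    · intro i hi
      rcases Nat.lt_succ_iff_lt_or_eq.mp hi with hi | rfl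
      · exact old _ (hy i hi)
      · rintro ⟨a, b, c, d⟩
        refine ⟨(0, 0, a, b), ?_⟩
        have c3 : X * Y * Y = 0 := by rw [mul_assoc, YY, mul_zero]
        change _ = _ * Y
        simp only [hΨ, map_zero, zero_mul, zero_add, add_zero, add_mul,
          mul_assoc (Φ _), YY, c3, mul_zero]

/-- Let `Λ` be the exterior algebra over a field `k` on `x_1,…,x_n,y_1,…,y_n` and
`w = ∑ x_i y_i`. If `char k = 0` or `char k > (n+1)/2`, then the total `k`-dimension of
the cokernel of multiplication by `w` plus the total `k`-dimension of its kernel equals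
the central binomial coefficient `C(2n+2, n+1)`. -/
theorem stmt_6 (k V : Type*) [Field k] [AddCommGroup V] [Module k V] (n : ℕ)
    (b : Basis (Fin n ⊕ Fin n) k V)
    (hchar : ∀ p : ℕ, CharP k p → p = 0 ∨ n + 1 < 2 * p) :
    let w : ExteriorAlgebra k V := ∑ i : Fin n, ι k (b (Sum.inl i)) * ι k (b (Sum.inr i))
    let f : ExteriorAlgebra k V →ₗ[k] ExteriorAlgebra k V := LinearMap.mulLeft k w
    finrank k (ExteriorAlgebra k V ⧸ LinearMap.range f) + finrank k (LinearMap.ker f)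
      = Nat.choose (2 * n + 2) (n + 1) := by
  intro w f
  let x : ℕ → V := fun i => if h : i < n then b (Sum.inl ⟨i, h⟩) else 0
  let y : ℕ → V := fun i => if h : i < n then b (Sum.inr ⟨i, h⟩) else 0
  have hc : ∀ i : ℕ, 2 * (i + 1) ≤ n + 1 → (i : k) + 1 ≠ 0 := by
    intro i hi h0
    obtain ⟨p, hp⟩ := CharP.exists k
    have hd : p ∣ i + 1 := (CharP.cast_eq_zero_iff k p (i + 1)).mp (by exact_mod_cast h0)
    rcases hchar p hp with rfl | h
    · simp at hd
    · have := Nat.le_of_dvd (by omega) hd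
      omega
  obtain ⟨E, i1, i2, i3, g, Φ, hd, -, hk, hw, ⟨e1, h1⟩, hx, hy⟩ := model (k := k) n hc x y n
  have hww : (∑ i ∈ Finset.range n, ι k (x i) * ι k (y i)) = w := by
    rw [Finset.sum_range]
    exact Finset.sum_congr rfl fun i _ => by simp [x, y]
  rw [hww] at hw
  let B := (b.reindex finSumFinEquiv).ExteriorAlgebra
  haveI : Module.Finite k (ExteriorAlgebra k V) := Module.Finite.of_basis B
  have hdim : finrank k (ExteriorAlgebra k V) = 4 ^ n := by
    rw [Module.finrank_eq_card_basis B, Fintype.card_finset, Fintype.card_fin, ← two_mul, pow_mul]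
    norm_num
  have hι : ∀ v : V, ∀ z ∈ LinearMap.range Φ, z * ι k v ∈ LinearMap.range Φ := by
    intro v z hz
    rw [← b.sum_repr v, map_sum, Finset.mul_sum]
    refine Submodule.sum_mem _ fun i _ => ?_
    rw [map_smul, mul_smul_comm]
    refine Submodule.smul_mem _ _ ?_
    obtain ⟨e, rfl⟩ := hz
    rcases i with i | i
    · obtain ⟨e', he⟩ := hx i i.2 e
      exact ⟨e', by rw [he]; simp [x]⟩
    · obtain ⟨e', he⟩ := hy i i.2 e
      exact ⟨e', by rw [he]; simp [y]⟩
  have hsurj : Function.Surjective Φ := by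
    intro z
    change z ∈ LinearMap.range Φ
    induction z using CliffordAlgebra.right_induction with
    | algebraMap r =>
      refine ⟨r • e1, ?_⟩
      rw [map_smul, h1]
      exact (Algebra.algebraMap_eq_smul_one r).symm
    | add a c ha hc => exact Submodule.add_mem _ ha hc
    | mul_ι v a ha => exact hι v a ha
  have hinj : Function.Injective Φ :=
    (LinearMap.injective_iff_surjective_of_finrank_eq_finrank (hd.trans hdim.symm)).mpr hsurj
  let e : E ≃ₗ[k] ExteriorAlgebra k V := LinearEquiv.ofBijective Φ ⟨hinj, hsurj⟩
  have hker : LinearMap.ker g = (LinearMap.ker f).comap e.toLinearMap := by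
    ext a
    have : f (e a) = Φ (g a) := (hw a).symm
    rw [Submodule.mem_comap, LinearMap.mem_ker, LinearMap.mem_ker, LinearEquiv.coe_coe, this,
      map_eq_zero_iff Φ hinj]
  have hk1 := hk 1 le_rfl
  rw [pow_one, hker, LinearEquiv.finrank_eq (LinearEquiv.ofSubmodule' _ _)] at hk1
  have r1 := Submodule.finrank_quotient_add_finrank (LinearMap.range f)
  have r2 := LinearMap.finrank_range_add_finrank_ker f
  have hs : Nat.choose (2 * n + 1) n = Nat.choose (2 * n + 1) (n + 1) :=
    Nat.choose_symm_of_eq_add (by ring)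
  have hp : Nat.choose (2 * n + 2) (n + 1) = _ := Nat.choose_succ_succ (2 * n + 1) n
  simp only [Finset.sum_range_one, add_zero] at hk1
  simp only [Nat.succ_eq_add_one] at hp
  omega
end

section
/- Let k be a field with char k \neq 2 and char k = 0 or char k > 5/2 (i.e., char k \geq 3), and let \Lambda be the exterior algebra on a k-vector space of dimension d \geq 8. Then there exists an element w in degree 2 of \Lambda such that dim_k Coker(\lambda_w) + dim_k Ker(\lambda_w) = 2^d - 2^{d-6} < 2^d, where \lambda_w is multiplication by w. -/
open ExteriorAlgebra Module

lemma ext_finite (k V : Type*) [Field k] [AddCommGroup V] [Module k V]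
    [FiniteDimensional k V] : FiniteDimensional k (ExteriorAlgebra k V) :=
  (Module.Basis.ExteriorAlgebra (finBasis k V)).finiteDimensional_of_finite

lemma ext_finrank (k V : Type*) [Field k] [AddCommGroup V] [Module k V]
    [FiniteDimensional k V] : finrank k (ExteriorAlgebra k V) = 2 ^ finrank k V := by
  rw [finrank_eq_card_basis (Module.Basis.ExteriorAlgebra (finBasis k V))]
  simp

lemma deg_two_central {k V : Type*} [Field k] [AddCommGroup V] [Module k V]
    {w : ExteriorAlgebra k V}
    (hw : w ∈ (LinearMap.range (ι k : V →ₗ[k] ExteriorAlgebra k V) ^ 2 :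
        Submodule k (ExteriorAlgebra k V))) (a : ExteriorAlgebra k V) : w * a = a * w := by
  rw [pow_two] at hw
  have key : ∀ v : V, w * ι k v = ι k v * w := by
    intro v
    induction hw using Submodule.mul_induction_on' with
    | mem_mul_mem m hm n hn =>
      obtain ⟨x, rfl⟩ := hm
      obtain ⟨y, rfl⟩ := hn
      have h1 := eq_neg_of_add_eq_zero_left (ι_add_mul_swap (R := k) y v)
      have h2 := eq_neg_of_add_eq_zero_left (ι_add_mul_swap (R := k) x v)
      rw [mul_assoc, h1, mul_neg, ← mul_assoc, h2, neg_mul, neg_neg, mul_assoc]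
    | add x _ y _ hx hy => rw [add_mul, mul_add, hx, hy]
  induction a using ExteriorAlgebra.induction with
  | algebraMap r => exact (Algebra.commutes r w).symm
  | ι v => exact key v
  | mul a b ha hb => rw [← mul_assoc, ha, mul_assoc, hb, mul_assoc]
  | add a b ha hb => rw [mul_add, add_mul, ha, hb]

/-- rank of left multiplication -/
noncomputable def rk (k : Type*) {A : Type*} [Field k] [Ring A] [Algebra k A] (a : A) : ℕ :=
  finrank k (LinearMap.range (LinearMap.mulLeft k a))

lemma finrank_range_conj {k M N : Type*} [Field k] [AddCommGroup M] [Module k M]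
    [AddCommGroup N] [Module k N] [FiniteDimensional k M] [FiniteDimensional k N]
    (h : finrank k M = finrank k N)
    (D : M →ₗ[k] M) (A : N →ₗ[k] N) (e f : M →ₗ[k] N)
    (he : Function.Surjective e) (hf : Function.Surjective f)
    (hc : ∀ m, A (e m) = f (D m)) :
    finrank k (LinearMap.range A) = finrank k (LinearMap.range D) := by
  have hfi := (LinearMap.injective_iff_surjective_of_finrank_eq_finrank h).2 hf
  have h1 : LinearMap.range A = (LinearMap.range D).map f := by
    rw [← LinearMap.range_comp, ← LinearMap.range_comp_of_range_eq_top A (LinearMap.range_eq_top.2 he)]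
    congr 1
    ext m
    exact hc m
  rw [h1]
  exact (Submodule.equivMapOfInjective f hfi _).finrank_eq.symm

lemma finrank_range_prodMap {k M N : Type*} [Field k] [AddCommGroup M] [Module k M]
    [AddCommGroup N] [Module k N] [FiniteDimensional k M] [FiniteDimensional k N]
    (f : M →ₗ[k] M) (g : N →ₗ[k] N) :
    finrank k (LinearMap.range (f.prodMap g)) =
      finrank k (LinearMap.range f) + finrank k (LinearMap.range g) := by
  rw [LinearMap.range_prodMap, ← finrank_prod]
  refine LinearEquiv.finrank_eq
    { toFun := fun x => (⟨x.1.1, x.2.1⟩, ⟨x.1.2, x.2.2⟩)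
      invFun := fun y => ⟨(y.1.1, y.2.1), y.1.2, y.2.2⟩
      map_add' := fun _ _ => rfl
      map_smul' := fun _ _ => rfl
      left_inv := fun _ => rfl
      right_inv := fun _ => rfl }

section step
variable {k V : Type*} [Field k] [AddCommGroup V] [Module k V]

/-- The inclusion of exterior algebras. -/
noncomputable def jj (k V : Type*) [Field k] [AddCommGroup V] [Module k V] :
    ExteriorAlgebra k V →ₐ[k] ExteriorAlgebra k (V × k × k) :=
  ExteriorAlgebra.map (LinearMap.inl k V (k × k))

/-- First new generator. -/
noncomputable def XX (k V : Type*) [Field k] [AddCommGroup V] [Module k V] :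
    ExteriorAlgebra k (V × k × k) := ι k (0, 1, 0)

/-- Second new generator. -/
noncomputable def YY (k V : Type*) [Field k] [AddCommGroup V] [Module k V] :
    ExteriorAlgebra k (V × k × k) := ι k (0, 0, 1)

/-- The comparison map. -/
noncomputable def Phi (k V : Type*) [Field k] [AddCommGroup V] [Module k V] :
    ((ExteriorAlgebra k V × ExteriorAlgebra k V) × (ExteriorAlgebra k V × ExteriorAlgebra k V))
      →ₗ[k] ExteriorAlgebra k (V × k × k) :=
  LinearMap.coprod
    (LinearMap.coprod (jj k V).toLinearMap
      (LinearMap.mulLeft k (XX k V * YY k V) ∘ₗ (jj k V).toLinearMap))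
    (LinearMap.coprod (LinearMap.mulLeft k (XX k V) ∘ₗ (jj k V).toLinearMap)
      (LinearMap.mulLeft k (YY k V) ∘ₗ (jj k V).toLinearMap))

lemma Phi_apply (a b c e : ExteriorAlgebra k V) :
    Phi k V ((a, b), (c, e)) = (jj k V a + XX k V * YY k V * jj k V b) +
      (XX k V * jj k V c + YY k V * jj k V e) := rfl

lemma XX_sq : XX k V * XX k V = 0 := ι_sq_zero _
lemma YY_sq : YY k V * YY k V = 0 := ι_sq_zero _
lemma YX : YY k V * XX k V = - (XX k V * YY k V) :=
  eq_neg_of_add_eq_zero_left (ι_add_mul_swap (R := k) _ _)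

lemma Phi_surj : Function.Surjective (Phi k V) := by
  have key : ∀ z : ExteriorAlgebra k (V × k × k), ∀ t ∈ LinearMap.range (Phi k V),
      z * t ∈ LinearMap.range (Phi k V) := by
    intro z
    induction z using ExteriorAlgebra.induction with
    | algebraMap r =>
      intro t ht
      rw [← Algebra.smul_def]
      exact Submodule.smul_mem _ _ ht
    | ι v =>
      obtain ⟨v, α, β⟩ := v
      rintro _ ⟨⟨⟨a, b⟩, ⟨c, e⟩⟩, rfl⟩
      have hv : (ι k (v, α, β) : ExteriorAlgebra k (V × k × k)) =
          jj k V (ι k v) + α • XX k V + β • YY k V := by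
        rw [jj, map_apply_ι, XX, YY, ← map_smul, ← map_smul, ← map_add, ← map_add]
        simp
      have hX : jj k V (ι k v) * XX k V = - (XX k V * jj k V (ι k v)) := by
        rw [jj, map_apply_ι]
        exact eq_neg_of_add_eq_zero_left (ι_add_mul_swap (R := k) _ _)
      have hY : jj k V (ι k v) * YY k V = - (YY k V * jj k V (ι k v)) := by
        rw [jj, map_apply_ι]
        exact eq_neg_of_add_eq_zero_left (ι_add_mul_swap (R := k) _ _)
      have h1 : jj k V (ι k v) * Phi k V ((a, b), (c, e)) ∈ LinearMap.range (Phi k V) := by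
        refine ⟨((ι k v * a, ι k v * b), (-(ι k v * c), -(ι k v * e))), ?_⟩
        simp only [Phi_apply, map_mul, map_neg]
        generalize jj k V (ι k v) = u at *
        generalize jj k V a = a at *
        generalize jj k V b = b at *
        generalize jj k V c = c at *
        generalize jj k V e = e at *
        have e1 : u * (XX k V * YY k V * b) = XX k V * YY k V * (u * b) := by
          rw [← mul_assoc, ← mul_assoc, hX, neg_mul, mul_assoc (XX k V), hY]
          simp only [mul_neg, neg_neg, neg_mul, mul_assoc]
        have e2 : u * (XX k V * c) = - (XX k V * (u * c)) := by
          rw [← mul_assoc, hX, neg_mul, mul_assoc]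
        have e3 : u * (YY k V * e) = - (YY k V * (u * e)) := by
          rw [← mul_assoc, hY, neg_mul, mul_assoc]
        rw [mul_add, mul_add, mul_add, e1, e2, e3]
        simp only [mul_neg]
      have h2 : XX k V * Phi k V ((a, b), (c, e)) ∈ LinearMap.range (Phi k V) := by
        refine ⟨((0, e), (a, 0)), ?_⟩
        simp only [Phi_apply, map_zero, mul_add, ← mul_assoc, XX_sq]
        simp [add_comm]
      have h3 : YY k V * Phi k V ((a, b), (c, e)) ∈ LinearMap.range (Phi k V) := by
        refine ⟨((0, -c), (0, a)), ?_⟩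
        simp only [Phi_apply, map_zero, mul_add, ← mul_assoc, YY_sq, YX, map_neg]
        rw [neg_mul, mul_assoc (XX k V) (YY k V) (YY k V), YY_sq]
        simp [add_comm]
      rw [hv, add_mul, add_mul, smul_mul_assoc, smul_mul_assoc]
      exact add_mem (add_mem h1 (Submodule.smul_mem _ _ h2)) (Submodule.smul_mem _ _ h3)
    | mul a b ha hb =>
      intro t ht
      rw [mul_assoc]
      exact ha _ (hb _ ht)
    | add a b ha hb =>
      intro t ht
      rw [add_mul]
      exact add_mem (ha _ ht) (hb _ ht)
  intro z
  have := key z 1 ⟨((1, 0), (0, 0)), by simp [Phi_apply]⟩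
  rwa [mul_one] at this

lemma rk_step [FiniteDimensional k V] (s c : ExteriorAlgebra k V) (hsc : s * c = c * s)
    (hsX : jj k V s * XX k V = XX k V * jj k V s) (hsY : jj k V s * YY k V = YY k V * jj k V s)
    (hcX : jj k V c * XX k V = XX k V * jj k V c) (hcY : jj k V c * YY k V = YY k V * jj k V c) :
    rk k (jj k V (s * c) + XX k V * YY k V * jj k V s) =
      rk k s + rk k (s * c ^ 2) + (rk k (s * c) + rk k (s * c)) := by
  have := ext_finite k V
  have := ext_finite k (V × k × k)
  have hz : ∀ a b p q : ExteriorAlgebra k V,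
      (jj k V (s * c) + XX k V * YY k V * jj k V s) * Phi k V ((a, b), (p, q)) =
      Phi k V ((s * c * a, s * a + s * c * b), (s * c * p, s * c * q)) := by
    intro a b p q
    have hS : jj k V (s * c) * XX k V = XX k V * jj k V (s * c) := by
      rw [map_mul, mul_assoc, hcX, ← mul_assoc, hsX, mul_assoc]
    have hT : jj k V (s * c) * YY k V = YY k V * jj k V (s * c) := by
      rw [map_mul, mul_assoc, hcY, ← mul_assoc, hsY, mul_assoc]
    simp only [Phi_apply, map_add]
    simp only [map_mul _ (s * c), map_mul _ s a]
    generalize jj k V (s * c) = u at *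
    generalize jj k V s = s at *
    generalize jj k V a = a at *
    generalize jj k V b = b at *
    generalize jj k V p = p at *
    generalize jj k V q = q at *
    have X2 := XX_sq (k := k) (V := V)
    have Y2 := YY_sq (k := k) (V := V)
    have yx := YX (k := k) (V := V)
    generalize XX k V = X at *
    generalize YY k V = Y at *
    have e1 : X * Y * s * (X * Y * b) = 0 := by
      have : X * Y * s * (X * Y * b) = X * (Y * (s * X)) * (Y * b) := by noncomm_ring
      rw [this, hsX, ← mul_assoc Y X, yx]
      have : X * (-(X * Y) * s) * (Y * b) = - (X * X * (Y * s * (Y * b))) := by noncomm_ring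
      rw [this, X2]; simp
    have e2 : X * Y * s * (X * p) = 0 := by
      have : X * Y * s * (X * p) = X * (Y * (s * X)) * p := by noncomm_ring
      rw [this, hsX, ← mul_assoc Y X, yx]
      have : X * (-(X * Y) * s) * p = - (X * X * (Y * s * p)) := by noncomm_ring
      rw [this, X2]; simp
    have e3 : X * Y * s * (Y * q) = 0 := by
      have : X * Y * s * (Y * q) = X * (Y * (s * Y)) * q := by noncomm_ring
      rw [this, hsY, ← mul_assoc Y Y, Y2]; simp
    have e4 : u * (X * Y * b) = X * Y * (u * b) := by
      rw [← mul_assoc, ← mul_assoc, hS, mul_assoc X, hT]; noncomm_ring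
    have e5 : u * (X * p) = X * (u * p) := by rw [← mul_assoc, hS, mul_assoc]
    have e6 : u * (Y * q) = Y * (u * q) := by rw [← mul_assoc, hT, mul_assoc]
    simp only [add_mul, mul_add, e1, e2, e3, e4, e5, e6]
    simp only [mul_assoc]
    abel
  let E := ExteriorAlgebra k V
  let e1 : ((E × E) × (E × E)) →ₗ[k] ((E × E) × (E × E)) :=
    LinearMap.prodMap (LinearMap.prod
      (LinearMap.fst k E E - LinearMap.mulLeft k c ∘ₗ LinearMap.snd k E E)
      (LinearMap.snd k E E)) LinearMap.id
  let e2 : ((E × E) × (E × E)) →ₗ[k] ((E × E) × (E × E)) :=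
    LinearMap.prodMap (LinearMap.prod
      (LinearMap.mulLeft k c ∘ₗ LinearMap.fst k E E - LinearMap.snd k E E)
      (LinearMap.fst k E E)) LinearMap.id
  have he1 : ∀ a b p q : E, e1 ((a, b), (p, q)) = ((a - c * b, b), (p, q)) := fun _ _ _ _ => rfl
  have he2 : ∀ a b p q : E, e2 ((a, b), (p, q)) = ((c * a - b, a), (p, q)) := fun _ _ _ _ => rfl
  have hs1 : Function.Surjective e1 := by
    rintro ⟨⟨a, b⟩, ⟨p, q⟩⟩
    exact ⟨((a + c * b, b), (p, q)), by rw [he1]; simp⟩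
  have hs2 : Function.Surjective e2 := by
    rintro ⟨⟨a, b⟩, ⟨p, q⟩⟩
    exact ⟨((b, c * b - a), (p, q)), by rw [he2]; simp⟩
  unfold rk
  rw [← finrank_range_prodMap, ← finrank_range_prodMap, ← finrank_range_prodMap]
  refine finrank_range_conj ?_ _ _ (Phi k V ∘ₗ e1) (Phi k V ∘ₗ e2)
    (Phi_surj.comp hs1) (Phi_surj.comp hs2) ?_
  · simp only [finrank_prod, ext_finrank, finrank_self]
    ring
  · rintro ⟨⟨a, b⟩, ⟨p, q⟩⟩
    simp only [LinearMap.comp_apply, he1, LinearMap.mulLeft_apply, hz, LinearMap.prodMap_apply, he2]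
    congr 3
    · rw [mul_sub, pow_two, hsc]
      simp only [← mul_assoc, hsc]
    · rw [mul_sub]
      simp only [← mul_assoc]
      abel

lemma rk_smul {A : Type*} [Ring A] [Algebra k A] (r : k) (hr : r ≠ 0) (a : A) :
    rk k (r • a) = rk k a := by
  unfold rk
  have : LinearMap.mulLeft k (r • a) = r • LinearMap.mulLeft k a := by
    ext; simp
  rw [this, LinearMap.range_smul _ _ hr]

lemma rk_zero {A : Type*} [Ring A] [Algebra k A] : rk k (0 : A) = 0 := by
  unfold rk
  rw [LinearMap.mulLeft_zero_eq_zero, LinearMap.range_zero, finrank_bot]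

lemma rk_one {A : Type*} [Ring A] [Algebra k A] : rk k (1 : A) = finrank k A := by
  unfold rk
  rw [LinearMap.mulLeft_one, LinearMap.range_id, finrank_top]

/-- degree two elements -/
abbrev D2 (k V : Type*) [Field k] [AddCommGroup V] [Module k V] :
    Submodule k (ExteriorAlgebra k V) :=
  LinearMap.range (ι k : V →ₗ[k] ExteriorAlgebra k V) ^ 2

lemma map_D2 {W : Type*} [AddCommGroup W] [Module k W] (f : V →ₗ[k] W)
    {w : ExteriorAlgebra k V} (hw : w ∈ D2 k V) : ExteriorAlgebra.map f w ∈ D2 k W := by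
  unfold D2 at *
  rw [pow_two] at *
  induction hw using Submodule.mul_induction_on' with
  | mem_mul_mem m hm n hn =>
    obtain ⟨x, rfl⟩ := hm
    obtain ⟨y, rfl⟩ := hn
    rw [map_mul, map_apply_ι, map_apply_ι]
    exact Submodule.mul_mem_mul ⟨_, rfl⟩ ⟨_, rfl⟩
  | add x _ y _ hx hy => rw [map_add]; exact add_mem hx hy

lemma XY_D2 : XX k V * YY k V ∈ D2 k (V × k × k) := by
  unfold D2
  rw [pow_two]
  exact Submodule.mul_mem_mul ⟨_, rfl⟩ ⟨_, rfl⟩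

/-- One step of the construction. -/
lemma exists_step [FiniteDimensional k V] (h2 : (2 : k) ≠ 0) {w : ExteriorAlgebra k V}
    (hw : w ∈ D2 k V) :
    ∃ w' ∈ D2 k (V × k × k),
      rk k w' = finrank k (ExteriorAlgebra k V) + rk k (w ^ 2) + 2 * rk k w ∧
      rk k (w' ^ 2) = rk k w + rk k (w ^ 3) + 2 * rk k (w ^ 2) ∧
      (w = 0 → w' ^ 2 = 0) ∧ (w ^ 2 = 0 → w' ^ 3 = 0) := by
  have hj : jj k V w ∈ D2 k (V × k × k) := map_D2 _ hw
  have hc := deg_two_central hj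
  have hxy := deg_two_central (XY_D2 (k := k) (V := V))
  have ht : (XX k V * YY k V) ^ 2 = 0 := by
    rw [pow_two, ← mul_assoc, mul_assoc (XX k V), YX, mul_neg, ← mul_assoc, XX_sq]
    simp
  have hcom : Commute (jj k V w) (XX k V * YY k V) := hc _
  refine ⟨jj k V w + XX k V * YY k V, add_mem hj XY_D2, ?_, ?_, ?_, ?_⟩
  · have := rk_step (k := k) (V := V) 1 w (by simp) (by simp) (by simp) (hc _) (hc _)
    simp only [map_one, one_mul, mul_one] at this
    rw [this, rk_one, two_mul]
  · have := rk_step (k := k) (V := V) ((2 : k) • w) ((2 : k)⁻¹ • w)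
      (by rw [smul_mul_smul_comm, smul_mul_smul_comm, mul_comm]) (by simp [hc]) (by simp [hc]) (by simp [hc]) (by simp [hc])
    have e1 : ((2 : k) • w) * ((2 : k)⁻¹ • w) = w ^ 2 := by
      rw [smul_mul_smul_comm, mul_inv_cancel₀ h2, one_smul, pow_two]
    have e2 : ((2 : k) • w) * ((2 : k)⁻¹ • w) ^ 2 = (2 : k)⁻¹ • w ^ 3 := by
      rw [pow_two, ← mul_assoc, e1, mul_smul_comm, ← pow_succ]
    rw [e1, e2, rk_smul _ h2, rk_smul _ (inv_ne_zero h2), ← two_mul] at this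
    rw [← this, hcom.add_sq, ht, map_pow, map_smul, add_zero, mul_assoc, hc, mul_smul_comm,
      two_mul, two_smul]
  · rintro rfl
    rw [map_zero, zero_add, ht]
  · intro h
    have h' : (jj k V w) ^ 2 = 0 := by rw [← map_pow, h, map_zero]
    have h3 : (jj k V w + XX k V * YY k V) ^ 2 = 2 * jj k V w * (XX k V * YY k V) := by
      rw [hcom.add_sq, h', ht]; simp
    have e1 : jj k V w * (XX k V * YY k V) * jj k V w = 0 := by
      rw [mul_assoc, ← hcom.eq, ← mul_assoc, ← pow_two, h', zero_mul]
    have e2 : jj k V w * (XX k V * YY k V) * (XX k V * YY k V) = 0 := by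
      rw [mul_assoc, ← pow_two, ht, mul_zero]
    rw [pow_succ, h3, mul_assoc 2, mul_assoc 2, mul_add, e1, e2, add_zero, mul_zero]

end step


/-- Let `k` be a field with `char k ≠ 2` and `Λ` the exterior algebra on a `k`-vector
space of dimension `d ≥ 8`. Then there is an element `w` of degree `2` such that
`dim coker(λ_w) + dim ker(λ_w) = 2^d - 2^(d-6) < 2^d`, where `λ_w` is multiplication
by `w`. -/
theorem stmt_9 (k V : Type*) [Field k] [AddCommGroup V] [Module k V]
    [FiniteDimensional k V] (d : ℕ) (hd : finrank k V = d) (hd8 : 8 ≤ d)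
    (hchar : ringChar k ≠ 2) :
    ∃ w ∈ (LinearMap.range (ι k : V →ₗ[k] ExteriorAlgebra k V) ^ 2 :
        Submodule k (ExteriorAlgebra k V)),
      finrank k (ExteriorAlgebra k V ⧸ LinearMap.range (LinearMap.mulLeft k w)) +
          finrank k (LinearMap.ker (LinearMap.mulLeft k w))
        = 2 ^ d - 2 ^ (d - 6) ∧
      2 ^ d - 2 ^ (d - 6) < 2 ^ d := by
  obtain ⟨n, rfl⟩ : ∃ n, d = n + 8 := ⟨_, (Nat.sub_add_cancel hd8).symm⟩
  have h2 : (2 : k) ≠ 0 := Ring.two_ne_zero hchar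
  obtain ⟨w1, m1, r1, -, s1, -⟩ := exists_step (k := k) (V := Fin n → k) h2
    (w := 0) (zero_mem _)
  obtain ⟨w2, m2, r2, q2, -, s2⟩ := exists_step h2 m1
  obtain ⟨w3, m3, r3, q3, -, -⟩ := exists_step h2 m2
  obtain ⟨w4, m4, r4, -, -, -⟩ := exists_step h2 m3
  have z1 := s1 rfl
  have z2 := s2 z1
  have z3 : w1 ^ 3 = 0 := by rw [pow_succ, z1, zero_mul]
  simp only [z1, z2, z3, rk_zero, ext_finrank, finrank_prod, finrank_self, finrank_fin_fun,
    zero_pow two_ne_zero] at r1 r2 q2 r3 q3 r4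
  have hrk : rk k w4 = 130 * 2 ^ n := by
    simp only [pow_add] at r1 r2 r3 r4
    omega
  have hfr : finrank k (((((Fin n → k) × k × k) × k × k) × k × k) × k × k)
      = finrank k V := by
    simp only [finrank_prod, finrank_self, finrank_fin_fun, hd]
  let e := LinearEquiv.ofFinrankEq _ _ hfr
  have := ext_finite k V
  have := ext_finite k (((((Fin n → k) × k × k) × k × k) × k × k) × k × k)
  have hs : Function.Surjective (ExteriorAlgebra.map e.toLinearMap) :=
    map_surjective_iff.2 e.surjective
  have hr : rk k (ExteriorAlgebra.map e.toLinearMap w4) = rk k w4 := by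
    refine finrank_range_conj ?_ _ _ (ExteriorAlgebra.map e.toLinearMap).toLinearMap
      (ExteriorAlgebra.map e.toLinearMap).toLinearMap hs hs ?_
    · rw [ext_finrank, ext_finrank, hfr]
    · intro m
      simp
  refine ⟨ExteriorAlgebra.map e.toLinearMap w4, map_D2 _ m4, ?_, ?_⟩
  · have a1 := Submodule.finrank_quotient_add_finrank
      (LinearMap.range (LinearMap.mulLeft k (ExteriorAlgebra.map e.toLinearMap w4)))
    have a2 := LinearMap.finrank_range_add_finrank_ker
      (LinearMap.mulLeft k (ExteriorAlgebra.map e.toLinearMap w4))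
    rw [hrk] at hr
    unfold rk at hr
    rw [hr, ext_finrank, hd] at a1 a2
    rw [show n + 8 - 6 = n + 2 by omega]
    simp only [pow_add] at a1 a2 ⊢
    omega
  · have : 0 < 2 ^ (n + 8 - 6) := by positivity
    have : 0 < 2 ^ (n + 8) := by positivity
    omega
end
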